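/- Let P be a set, F = F(P) the free abelian monoid over P, and H ⊆ F a submonoid such that the inclusion H ↪ F is a divisor theory whose class group G = q(F)/q(H) is finitely generated. Then there exist a finitely generated abelian group G*, a subset G_0* ⊆ G* such that the inclusion B(G_0*) ↪ F(G_0*) is a divisor theory, and a transfer homomorphism θ*: H → B(G_0*); moreover L(H) = L(B(G_0*)). -/

import Mathlib

open scoped Classical

/-- The monoid of zero-sum multisets over `G0 ⊆ G` (monoid of zero-sum sequences `B(G0)`),
realized as an additive submonoid of the free abelian monoid `F(G0)` of multisets. -/
def ZeroSum {G : Type*} [AddCommGroup G] (G0 : Set G) : AddSubmonoid (Multiset G) where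
  carrier := {S | (∀ x ∈ S, x ∈ G0) ∧ S.sum = 0}
  zero_mem' := ⟨fun x hx => absurd hx (Multiset.notMem_zero x), Multiset.sum_zero⟩
  add_mem' := by
    rintro a b ⟨ha1, ha2⟩ ⟨hb1, hb2⟩
    refine ⟨fun x hx => ?_, ?_⟩
    · rcases Multiset.mem_add.mp hx with h | h
      exacts [ha1 x h, hb1 x h]
    · rw [Multiset.sum_add, ha2, hb2, add_zero]

/-- The inclusion `B(G0) ↪ F(G0)` is a divisor theory: every `g ∈ G0` is the
greatest common divisor (pointwise minimum of multiplicities) of a finite nonempty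
set of zero-sum sequences. -/
def IsDivisorTheoryB {G : Type*} [AddCommGroup G] (G0 : Set G) : Prop :=
  ∀ g ∈ G0, ∃ (X : Finset (Multiset G)) (hX : X.Nonempty),
    (X : Set (Multiset G)) ⊆ (ZeroSum G0 : Set (Multiset G)) ∧
      ∀ h : G, X.inf' hX (fun B => Multiset.count h B) = Multiset.count h ({g} : Multiset G)

/-- A transfer homomorphism between reduced commutative (additive) monoids:
surjective, trivial kernel as a preimage of `0`, and factorizations lift. -/
def IsTransferHomAdd {M N : Type*} [AddCommMonoid M] [AddCommMonoid N] (θ : M →+ N) : Prop :=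
  Function.Surjective θ ∧ (∀ a : M, θ a = 0 → a = 0) ∧
    ∀ (u : M) (b c : N), θ u = b + c → ∃ v w : M, u = v + w ∧ θ v = b ∧ θ w = c

/-- The canonical embedding of the free abelian monoid `F(P)` into its quotient group
`q(F)`, i.e. of `P →₀ ℕ` into `P →₀ ℤ`. -/
noncomputable def toIntF {P : Type*} : (P →₀ ℕ) →+ (P →₀ ℤ) :=
  Finsupp.mapRange.addMonoidHom (Nat.castAddMonoidHom ℤ)

/-- The inclusion `H ↪ F(P)` is a divisor homomorphism. -/
def IsDivHomF {P : Type*} (H : AddSubmonoid (P →₀ ℕ)) : Prop :=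
  ∀ a ∈ H, ∀ b ∈ H, a ≤ b → b - a ∈ H

/-- The inclusion `H ↪ F(P)` is cofinal. -/
def IsCofinalF {P : Type*} (H : AddSubmonoid (P →₀ ℕ)) : Prop :=
  ∀ x : P →₀ ℕ, ∃ h ∈ H, x ≤ h

/-- The inclusion `H ↪ F(P)` is a divisor theory: a divisor homomorphism such that every
`p ∈ P` is the pointwise infimum of a finite nonempty subset of `H`. -/
def IsDivTheoryF {P : Type*} (H : AddSubmonoid (P →₀ ℕ)) : Prop :=
  IsDivHomF H ∧ ∀ p : P, ∃ (X : Finset (P →₀ ℕ)) (hX : X.Nonempty),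
    (X : Set (P →₀ ℕ)) ⊆ (H : Set (P →₀ ℕ)) ∧
      ∀ q : P, X.inf' hX (fun h => h q) = Finsupp.single p 1 q

/-- The quotient group `q(H)` of `H`, as a subgroup of `q(F) = (P →₀ ℤ)`. -/
noncomputable def qHsub {P : Type*} (H : AddSubmonoid (P →₀ ℕ)) : AddSubgroup (P →₀ ℤ) :=
  AddSubgroup.closure (⇑toIntF '' (H : Set (P →₀ ℕ)))

/-- The class group `G = q(F)/q(H)` of the inclusion `H ↪ F(P)`. -/
abbrev ClassGrp {P : Type*} (H : AddSubmonoid (P →₀ ℕ)) : Type _ :=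
  (P →₀ ℤ) ⧸ qHsub H

/-- The canonical projection `q(F) → G`, `x ↦ [x]`. -/
noncomputable def clsOf {P : Type*} (H : AddSubmonoid (P →₀ ℕ)) : (P →₀ ℤ) →+ ClassGrp H :=
  QuotientAddGroup.mk' (qHsub H)

/-- The set `G_P = {[p] : p ∈ P}` of classes containing prime divisors. -/
def GPset {P : Type*} (H : AddSubmonoid (P →₀ ℕ)) : Set (ClassGrp H) :=
  {g | ∃ p : P, g = clsOf H (Finsupp.single p 1)}

/-- An atom (irreducible element) of an additive commutative monoid. -/
def IsAddAtom {M : Type*} [AddCommMonoid M] (u : M) : Prop :=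
  ¬ IsAddUnit u ∧ ∀ b c : M, u = b + c → IsAddUnit b ∨ IsAddUnit c

/-- The set of lengths of an element: `{0}` for units, and the set of all `n` such that
`a` is a sum of `n` atoms otherwise. -/
def addLengthSet {M : Type*} [AddCommMonoid M] (a : M) : Set ℕ :=
  {n | (IsAddUnit a ∧ n = 0) ∨
    (¬ IsAddUnit a ∧ ∃ l : List M, l.length = n ∧ (∀ x ∈ l, IsAddAtom x) ∧ l.sum = a)}

/-- The system of sets of lengths `L(M) = {L(a) : a ∈ M}`. -/
def addSystemOfLengths (M : Type*) [AddCommMonoid M] : Set (Set ℕ) :=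
  Set.range (addLengthSet (M := M))

/-- A finitely generated abelian group. -/
def IsFGAdd (G : Type*) [AddCommGroup G] : Prop :=
  ∃ S : Finset G, AddSubgroup.closure (S : Set G) = ⊤

/-- A splitting of `s.map f` lifts to a splitting of `s`. -/
theorem Multiset.exists_add_of_map_eq_add {α β : Type*} (f : α → β) (s : Multiset α)
    (b c : Multiset β) (h : s.map f = b + c) :
    ∃ v w : Multiset α, s = v + w ∧ v.map f = b ∧ w.map f = c := by
  induction s using Multiset.induction_on generalizing b c with
  | empty =>
    obtain ⟨rfl, rfl⟩ : b = 0 ∧ c = 0 := by simpa [eq_comm] using h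
    exact ⟨0, 0, by simp⟩
  | cons a s ih =>
    have hmem : f a ∈ b + c := by rw [← h]; simp
    rcases Multiset.mem_add.mp hmem with hb | hc
    · obtain ⟨b', rfl⟩ := Multiset.exists_cons_of_mem hb
      obtain ⟨v, w, rfl, rfl, rfl⟩ := ih b' c (by simpa using h)
      exact ⟨a ::ₘ v, w, by simp⟩
    · obtain ⟨c', rfl⟩ := Multiset.exists_cons_of_mem hc
      obtain ⟨v, w, rfl, rfl, rfl⟩ := ih b c' (by simpa using h)
      exact ⟨v, a ::ₘ w, by simp⟩

/-- A multiset over the image `f '' A` is the image of a multiset over `A`. -/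
theorem Multiset.exists_map_eq_of_forall_mem_image {α β : Type*} (f : α → β) (A : Set α)
    (t : Multiset β) (h : ∀ x ∈ t, x ∈ f '' A) :
    ∃ s : Multiset α, (∀ x ∈ s, x ∈ A) ∧ s.map f = t := by
  induction t using Multiset.induction_on with
  | empty => exact ⟨0, by simp⟩
  | cons a t ih =>
    obtain ⟨s, hs, rfl⟩ := ih fun x hx => h x (Multiset.mem_cons_of_mem hx)
    obtain ⟨p, hp, rfl⟩ := h a (Multiset.mem_cons_self a _)
    exact ⟨p ::ₘ s, by simpa [hp] using hs, by simp⟩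

/-- Separate the occurrences of `h` in a multiset. -/
theorem Multiset.filter_ne_add_replicate {G : Type*} (S : Multiset G) (h : G) :
    S.filter (· ≠ h) + Multiset.replicate (S.count h) h = S := by
  rw [← Multiset.filter_eq', add_comm]
  exact Multiset.filter_add_not (· = h) S

theorem Multiset.filter_ne_replicate {G : Type*} (n : ℕ) (h : G) :
    (Multiset.replicate n h).filter (· ≠ h) = 0 :=
  Multiset.filter_eq_nil.mpr fun _ hx => not_not.mpr (Multiset.eq_of_mem_replicate hx)

theorem Multiset.sum_filter_ne_add {G : Type*} [AddCommMonoid G] (S : Multiset G) (h : G) :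
    (S.filter (· ≠ h)).sum + S.count h • h = S.sum := by
  conv_rhs => rw [← S.filter_ne_add_replicate h]
  simp

theorem IsTransferHomAdd.comp {M N L : Type*} [AddCommMonoid M] [AddCommMonoid N]
    [AddCommMonoid L] {g : N →+ L} {f : M →+ N} (hg : IsTransferHomAdd g)
    (hf : IsTransferHomAdd f) : IsTransferHomAdd (g.comp f) := by
  refine ⟨hg.1.comp hf.1, fun a ha => hf.2.1 a (hg.2.1 _ ha), fun u b c h => ?_⟩
  obtain ⟨v, w, hvw, rfl, rfl⟩ := hg.2.2 (f u) b c h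
  obtain ⟨v', w', rfl, rfl, rfl⟩ := hf.2.2 u v w hvw
  exact ⟨v', w', rfl, rfl, rfl⟩

section Lengths

variable {M N : Type*} [AddCommMonoid M] [AddCommMonoid N]

theorem IsTransferHomAdd.isAddUnit_iff {θ : M →+ N} (hθ : IsTransferHomAdd θ)
    (hM : ∀ a : M, IsAddUnit a → a = 0) (hN : ∀ a : N, IsAddUnit a → a = 0) (a : M) :
    IsAddUnit (θ a) ↔ IsAddUnit a := by
  refine ⟨fun h => ?_, fun h => ?_⟩
  · rw [hθ.2.1 a (hN _ h)]; exact isAddUnit_zero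
  · rw [hM a h, map_zero]; exact isAddUnit_zero

theorem IsTransferHomAdd.isAddAtom_iff {θ : M →+ N} (hθ : IsTransferHomAdd θ)
    (hM : ∀ a : M, IsAddUnit a → a = 0) (hN : ∀ a : N, IsAddUnit a → a = 0) (a : M) :
    IsAddAtom (θ a) ↔ IsAddAtom a := by
  have hu := hθ.isAddUnit_iff hM hN
  refine ⟨fun h => ⟨fun h' => h.1 ((hu a).2 h'), fun b c hbc => ?_⟩,
    fun h => ⟨fun h' => h.1 ((hu a).1 h'), fun b c hbc => ?_⟩⟩
  · rw [← hu b, ← hu c]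
    exact h.2 _ _ (by rw [hbc, map_add])
  · obtain ⟨v, w, hvw, rfl, rfl⟩ := hθ.2.2 a b c hbc
    rw [hu, hu]
    exact h.2 v w hvw

theorem IsTransferHomAdd.exists_list {θ : M →+ N} (hθ : IsTransferHomAdd θ) (l : List N) :
    ∀ a : M, θ a = l.sum → ∃ k : List M, k.map θ = l ∧ k.sum = a := by
  induction l with
  | nil => exact fun a ha => ⟨[], rfl, (hθ.2.1 a ha).symm⟩
  | cons x l ih =>
    intro a ha
    obtain ⟨v, w, rfl, rfl, hw⟩ := hθ.2.2 a x l.sum (by simpa using ha)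
    obtain ⟨k, rfl, rfl⟩ := ih w hw
    exact ⟨v :: k, by simp, by simp⟩

theorem IsTransferHomAdd.addLengthSet_eq {θ : M →+ N} (hθ : IsTransferHomAdd θ)
    (hM : ∀ a : M, IsAddUnit a → a = 0) (hN : ∀ a : N, IsAddUnit a → a = 0) (a : M) :
    addLengthSet (θ a) = addLengthSet a := by
  have hu := hθ.isAddUnit_iff hM hN
  have hat := hθ.isAddAtom_iff hM hN
  ext n
  simp only [addLengthSet, Set.mem_ofPred_eq, hu]
  refine or_congr Iff.rfl (and_congr Iff.rfl ⟨?_, ?_⟩)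
  · rintro ⟨l, rfl, hl, hsum⟩
    obtain ⟨k, rfl, hk⟩ := hθ.exists_list l a hsum.symm
    exact ⟨k, by simp, fun x hx => (hat x).1 (hl _ (List.mem_map_of_mem hx)), hk⟩
  · rintro ⟨k, rfl, hk, rfl⟩
    refine ⟨k.map θ, by simp, fun x hx => ?_, by simp [map_list_sum]⟩
    obtain ⟨y, hy, rfl⟩ := List.mem_map.mp hx
    exact (hat y).2 (hk y hy)

theorem IsTransferHomAdd.addSystemOfLengths_eq {θ : M →+ N} (hθ : IsTransferHomAdd θ)
    (hM : ∀ a : M, IsAddUnit a → a = 0) (hN : ∀ a : N, IsAddUnit a → a = 0) :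
    addSystemOfLengths M = addSystemOfLengths N := by
  have h : addLengthSet (M := M) = addLengthSet (M := N) ∘ θ :=
    funext fun a => (hθ.addLengthSet_eq hM hN a).symm
  rw [addSystemOfLengths, addSystemOfLengths, h, hθ.1.range_comp]

end Lengths

theorem AddSubmonoid.eq_zero_of_isAddUnit {A : Type*} [AddCommMonoid A] [Subsingleton (AddUnits A)]
    (H : AddSubmonoid A) (a : H) (ha : IsAddUnit a) : a = 0 := by
  have h : IsAddUnit (H.subtype a) := ha.map H.subtype
  exact Subtype.ext (isAddUnit_iff_eq_zero.mp h)

/-- If `ψ` identifies `M` with the multisets over `P0` whose image under `φ` has sum zero, then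
`M` has a transfer homomorphism onto the monoid of zero-sum sequences over `φ '' P0`. -/
theorem exists_transferHom_zeroSum {M P G : Type*} [AddCommMonoid M] [AddCommGroup G]
    (ψ : M →+ Multiset P) (hψ : Function.Injective ψ) (P0 : Set P) (φ : P → G)
    (hrange : ∀ s : Multiset P, (∃ m, ψ m = s) ↔ (∀ p ∈ s, p ∈ P0) ∧ (s.map φ).sum = 0) :
    ∃ θ : M →+ ZeroSum (φ '' P0), IsTransferHomAdd θ ∧ ∀ m, (θ m : Multiset G) = (ψ m).map φ := by
  have hm : ∀ m, (ψ m).map φ ∈ ZeroSum (φ '' P0) := fun m => by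
    obtain ⟨h1, h2⟩ := (hrange (ψ m)).1 ⟨m, rfl⟩
    refine ⟨fun x hx => ?_, h2⟩
    obtain ⟨p, hp, rfl⟩ := Multiset.mem_map.mp hx
    exact ⟨p, h1 p hp, rfl⟩
  refine ⟨((Multiset.mapAddMonoidHom φ).comp ψ).codRestrict _ hm, ⟨?_, ?_, ?_⟩, fun m => rfl⟩
  · rintro ⟨t, ht1, ht2⟩
    obtain ⟨s, hs, rfl⟩ := Multiset.exists_map_eq_of_forall_mem_image φ P0 t ht1
    obtain ⟨m, rfl⟩ := (hrange s).2 ⟨hs, ht2⟩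
    exact ⟨m, rfl⟩
  · intro a ha
    have h : (ψ a).map φ = 0 := congrArg Subtype.val ha
    exact hψ (by rw [map_zero]; exact Multiset.map_eq_zero.mp h)
  · rintro u ⟨b, hb⟩ ⟨c, hc⟩ h
    have h' : (ψ u).map φ = b + c := congrArg Subtype.val h
    obtain ⟨s, t, hst, rfl, rfl⟩ := Multiset.exists_add_of_map_eq_add φ _ b c h'
    have hP := ((hrange (ψ u)).1 ⟨u, rfl⟩).1
    rw [hst] at hP
    obtain ⟨v, rfl⟩ := (hrange s).2 ⟨fun p hp => hP p (Multiset.mem_add.mpr (.inl hp)), hb.2⟩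
    obtain ⟨w, rfl⟩ := (hrange t).2 ⟨fun p hp => hP p (Multiset.mem_add.mpr (.inr hp)), hc.2⟩
    exact ⟨v, w, hψ (by rw [hst, map_add]), rfl, rfl⟩

/-- The subgroup generated by a zero-sum sequence is generated as a monoid. -/
theorem mem_addSubmonoid_closure_of_sum_eq_zero {G : Type*} [AddCommGroup G] {S : Multiset G}
    (hS : S.sum = 0) {x : G} (hx : x ∈ AddSubgroup.closure {g | g ∈ S}) :
    x ∈ AddSubmonoid.closure {g | g ∈ S} := by
  have hneg : ∀ y ∈ AddSubmonoid.closure {g | g ∈ S}, -y ∈ AddSubmonoid.closure {g | g ∈ S} := by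
    intro y hy
    induction hy using AddSubmonoid.closure_induction with
    | mem y hy =>
      have h : -y = (S.erase y).sum :=
        neg_eq_of_add_eq_zero_right (by rw [← Multiset.sum_cons, Multiset.cons_erase hy, hS])
      rw [h]
      exact AddSubmonoid.multiset_sum_mem _ _ fun z hz =>
        AddSubmonoid.subset_closure (Multiset.mem_of_mem_erase hz)
    | zero => simp
    | add y z _ _ hy hz => rw [neg_add]; exact add_mem hy hz
  induction hx using AddSubgroup.closure_induction with
  | mem y hy => exact AddSubmonoid.subset_closure hy
  | zero => exact zero_mem _
  | add y z _ _ hy hz => exact add_mem hy hz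
  | neg y _ hy => exact hneg y hy

/-- If `-g` is a sum of elements of `G0 \ {h}` for all `g, h ∈ G0`, then the inclusion of the
monoid of zero-sum sequences over `G0` is a divisor theory. -/
theorem isDivisorTheoryB_of_neg_mem_closure {G : Type*} [AddCommGroup G] {G0 : Set G}
    (h : ∀ g ∈ G0, ∀ k ∈ G0, -g ∈ AddSubmonoid.closure (G0 \ {k})) : IsDivisorTheoryB G0 := by
  intro g hg
  have key : ∀ k ∈ G0, ∃ T : Multiset G, (∀ x ∈ T, x ∈ G0 ∧ x ≠ k) ∧ T.sum = -g :=
    fun k hk => AddSubmonoid.exists_multiset_of_mem_closure (h g hg k hk)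
  choose! T hT hTsum using key
  have hmem : ∀ k ∈ G0, g ::ₘ T k ∈ ZeroSum G0 := fun k hk =>
    ⟨by simpa [hg] using fun x hx => (hT k hk x hx).1, by simp [hTsum k hk]⟩
  have hsub : ∀ k ∈ (g ::ₘ T g).toFinset, k ∈ G0 := fun k hk =>
    (hmem g hg).1 k (Multiset.mem_toFinset.mp hk)
  have hne : ((g ::ₘ T g).toFinset.image fun k => g ::ₘ T k).Nonempty :=
    ⟨g ::ₘ T g, Finset.mem_image_of_mem (fun k => g ::ₘ T k) (by simp)⟩
  refine ⟨(g ::ₘ T g).toFinset.image fun k => g ::ₘ T k, hne, ?_, fun k => le_antisymm ?_ ?_⟩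
  · intro B hB
    obtain ⟨k, hk, rfl⟩ := Finset.mem_image.mp (Finset.mem_coe.mp hB)
    exact hmem k (hsub k hk)
  · by_cases hk : k ∈ (g ::ₘ T g).toFinset
    · refine (Finset.inf'_le _ (Finset.mem_image_of_mem _ hk)).trans ?_
      have h0 : (T k).count k = 0 :=
        Multiset.count_eq_zero.mpr fun hx => (hT k (hsub k hk) k hx).2 rfl
      simp [Multiset.count_cons, h0, Multiset.count_singleton]
    · refine (Finset.inf'_le _ (Finset.mem_image_of_mem _
        (Multiset.mem_toFinset.mpr (Multiset.mem_cons_self g (T g))))).trans ?_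
      rw [Multiset.count_eq_zero.mpr fun hx => hk (Multiset.mem_toFinset.mpr hx)]
      exact Nat.zero_le _
  · refine Finset.le_inf' _ _ fun B hB => ?_
    obtain ⟨j, -, rfl⟩ := Finset.mem_image.mp hB
    exact Multiset.count_le_of_le k (Multiset.singleton_le.mpr (Multiset.mem_cons_self g (T j)))

theorem IsFGAdd.of_surjective {G G' : Type*} [AddCommGroup G] [AddCommGroup G'] (f : G →+ G')
    (hf : Function.Surjective f) (h : IsFGAdd G) : IsFGAdd G' := by
  obtain ⟨S, hS⟩ := h
  refine ⟨S.image f, ?_⟩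
  rw [Finset.coe_image, ← AddMonoidHom.map_closure, hS, ← AddMonoidHom.range_eq_map,
    AddMonoidHom.range_eq_top.mpr hf]

section Reduction

variable {G : Type*} [AddCommGroup G] {G0 : Set G}

/-- If no positive multiple of `h` is a sum of elements of `G0 \ {h}`, then `h` can be removed
after passing to the quotient by the multiples of `h`. -/
theorem exists_transferHom_quotient {h : G} (hG0 : h ∈ G0)
    (hh : ∀ m : ℕ, 0 < m → m • h ∉ AddSubmonoid.closure (G0 \ {h})) :
    ∃ θ : ZeroSum G0 →+ ZeroSum (QuotientAddGroup.mk' (AddSubgroup.zmultiples h) '' (G0 \ {h})),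
      IsTransferHomAdd θ ∧ ∀ S, (θ S : Multiset (G ⧸ AddSubgroup.zmultiples h)) =
        ((S : Multiset G).filter (· ≠ h)).map (QuotientAddGroup.mk' (AddSubgroup.zmultiples h)) := by
  let ψ : ZeroSum G0 →+ Multiset G :=
    { toFun := fun S => (S : Multiset G).filter (· ≠ h)
      map_zero' := by simp
      map_add' := by simp }
  have horder : ∀ k l : ℕ, k • h = l • h → k = l := by
    have aux : ∀ k l : ℕ, k < l → k • h ≠ l • h := fun k l hkl he => by
      refine hh (l - k) (by omega) ?_
      have h0 : (l - k) • h = 0 := by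
        rw [← add_left_cancel_iff (a := k • h), ← add_nsmul, Nat.add_sub_cancel' hkl.le, he,
          add_zero]
      rw [h0]; exact zero_mem _
    intro k l he
    rcases lt_trichotomy k l with hkl | hkl | hkl
    exacts [absurd he (aux k l hkl), hkl, absurd he.symm (aux l k hkl)]
  refine exists_transferHom_zeroSum ψ ?_ (G0 \ {h}) _ fun s => ⟨?_, ?_⟩
  · intro S T hST
    have hST' : (S : Multiset G).filter (· ≠ h) = (T : Multiset G).filter (· ≠ h) := hST
    have hS := (S : Multiset G).sum_filter_ne_add h
    have hT := (T : Multiset G).sum_filter_ne_add h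
    rw [S.2.2, hST'] at hS
    rw [T.2.2, ← hS] at hT
    have hc := horder _ _ (add_left_cancel hT)
    refine Subtype.ext ?_
    rw [← (S : Multiset G).filter_ne_add_replicate h,
      ← (T : Multiset G).filter_ne_add_replicate h, hST', hc]
  · rintro ⟨S, rfl⟩
    refine ⟨fun p hp => ?_, ?_⟩
    · obtain ⟨hp1, hp2⟩ := Multiset.mem_filter.mp hp
      exact ⟨S.2.1 p hp1, hp2⟩
    · have hS := (S : Multiset G).sum_filter_ne_add h
      rw [S.2.2] at hS
      rw [← map_multiset_sum]
      refine (QuotientAddGroup.eq_zero_iff _).mpr ?_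
      change ((S : Multiset G).filter (· ≠ h)).sum ∈ _
      rw [eq_neg_of_add_eq_zero_left hS]
      exact neg_mem (nsmul_mem (AddSubgroup.mem_zmultiples h) _)
  · rintro ⟨hs, hsum⟩
    rw [← map_multiset_sum] at hsum
    obtain ⟨k, hk⟩ := AddSubgroup.mem_zmultiples_iff.mp ((QuotientAddGroup.eq_zero_iff _).mp hsum)
    have hsc : s.sum ∈ AddSubmonoid.closure (G0 \ {h}) :=
      AddSubmonoid.multiset_sum_mem _ _ fun x hx => AddSubmonoid.subset_closure (hs x hx)
    have hk0 : k ≤ 0 := by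
      by_contra! hpos
      lift k to ℕ using hpos.le
      exact hh k (by omega) (by rw [← natCast_zsmul, hk]; exact hsc)
    obtain ⟨n, rfl⟩ : ∃ n : ℕ, k = -n := ⟨(-k).toNat, by omega⟩
    refine ⟨⟨s + Multiset.replicate n h, fun x hx => ?_, ?_⟩, ?_⟩
    · rcases Multiset.mem_add.mp hx with hx | hx
      · exact (hs x hx).1
      · rwa [Multiset.eq_of_mem_replicate hx]
    · simp [← hk]
    · change (s + Multiset.replicate n h).filter (· ≠ h) = s
      rw [Multiset.filter_add, Multiset.filter_ne_replicate, add_zero]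
      exact Multiset.filter_eq_self.mpr fun x hx => (hs x hx).2

/-- If the multiplicity of `h` in every zero-sum sequence over `G0` is divisible by `n`, then `h`
can be replaced by `n • h`. -/
theorem exists_transferHom_nsmul {h : G} (hG0 : h ∈ G0) {n : ℕ} (hn : 0 < n)
    (hdvd : ∀ S ∈ ZeroSum G0, n ∣ S.count h) :
    ∃ θ : ZeroSum G0 →+ ZeroSum ((fun g => if g = h then n • h else g) '' G0),
      IsTransferHomAdd θ ∧ ∀ S, (θ S : Multiset G) =
        (S : Multiset G).filter (· ≠ h) +
          Multiset.replicate ((S : Multiset G).count h / n) (n • h) := by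
  let φ : G → G := fun g => if g = h then n • h else g
  let ψ : ZeroSum G0 →+ Multiset G :=
    { toFun := fun S => (S : Multiset G).filter (· ≠ h) +
        Multiset.replicate ((S : Multiset G).count h / n) h
      map_zero' := by simp
      map_add' := fun S T => by
        simp only [AddSubmonoid.coe_add, Multiset.filter_add, Multiset.count_add,
          Nat.add_div_of_dvd_right (hdvd S S.2), Multiset.replicate_add]
        abel }
  have hφ : ∀ s : Multiset G, (s.filter (· ≠ h)).map φ = s.filter (· ≠ h) := fun s => by
    conv_rhs => rw [← Multiset.map_id (s.filter (· ≠ h))]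
    exact Multiset.map_congr rfl fun x hx => if_neg (Multiset.mem_filter.mp hx).2
  have hφh : φ h = n • h := if_pos rfl
  have hψφ : ∀ S, (ψ S).map φ = (S : Multiset G).filter (· ≠ h) +
      Multiset.replicate ((S : Multiset G).count h / n) (n • h) := fun S => by
    change Multiset.map φ (_ + _) = _
    rw [Multiset.map_add, hφ, Multiset.map_replicate, hφh]
  have hfilter : ∀ (s : Multiset G) (k : ℕ),
      (s.filter (· ≠ h) + Multiset.replicate k h).filter (· ≠ h) = s.filter (· ≠ h) := fun s k => by
    rw [Multiset.filter_add, Multiset.filter_ne_replicate, add_zero, Multiset.filter_filter]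
    simp
  have hcount : ∀ (s : Multiset G) (k : ℕ),
      (s.filter (· ≠ h) + Multiset.replicate k h).count h = k := fun s k => by
    simp
  suffices H : ∃ θ : ZeroSum G0 →+ ZeroSum (φ '' G0), IsTransferHomAdd θ ∧
      ∀ S, (θ S : Multiset G) = (ψ S).map φ by
    obtain ⟨θ, h1, h2⟩ := H
    exact ⟨θ, h1, fun S => (h2 S).trans (hψφ S)⟩
  refine exists_transferHom_zeroSum ψ ?_ G0 φ fun s => ⟨?_, ?_⟩
  · intro S T hST
    have hST' : (S : Multiset G).filter (· ≠ h) +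
        Multiset.replicate ((S : Multiset G).count h / n) h = (T : Multiset G).filter (· ≠ h) +
        Multiset.replicate ((T : Multiset G).count h / n) h := hST
    have hf := congrArg (Multiset.filter (· ≠ h)) hST'
    have hc := congrArg (Multiset.count h) hST'
    rw [hfilter, hfilter] at hf
    rw [hcount, hcount] at hc
    refine Subtype.ext ?_
    rw [← (S : Multiset G).filter_ne_add_replicate h,
      ← (T : Multiset G).filter_ne_add_replicate h, hf,
      ← Nat.div_mul_cancel (hdvd S S.2), hc, Nat.div_mul_cancel (hdvd T T.2)]
  · rintro ⟨S, rfl⟩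
    refine ⟨fun p hp => ?_, ?_⟩
    · rcases Multiset.mem_add.mp hp with hp | hp
      · exact S.2.1 p (Multiset.mem_of_mem_filter hp)
      · rwa [Multiset.eq_of_mem_replicate hp]
    · rw [hψφ, Multiset.sum_add, Multiset.sum_replicate, ← mul_nsmul',
        Nat.div_mul_cancel (hdvd S S.2), Multiset.sum_filter_ne_add, S.2.2]
  · rintro ⟨hs, hsum⟩
    refine ⟨⟨s.filter (· ≠ h) + Multiset.replicate (s.count h * n) h, fun x hx => ?_, ?_⟩, ?_⟩
    · rcases Multiset.mem_add.mp hx with hx | hx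
      · exact hs x (Multiset.mem_of_mem_filter hx)
      · rwa [Multiset.eq_of_mem_replicate hx]
    · rw [← s.filter_ne_add_replicate h, Multiset.map_add, hφ, Multiset.map_replicate, hφh,
        Multiset.sum_add, Multiset.sum_replicate, ← mul_nsmul'] at hsum
      rwa [Multiset.sum_add, Multiset.sum_replicate]
    · change Multiset.filter (· ≠ h) (_ + _) + Multiset.replicate (Multiset.count h (_ + _) / n) h = s
      rw [hfilter, hcount, Nat.mul_div_cancel _ hn, Multiset.filter_ne_add_replicate]

/-- If some positive multiple of `h` is a sum of elements of `G0 \ {h}`, and `G0` generates a group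
as a monoid, then so does `G0 \ {h}`. -/
theorem neg_mem_closure_of_nsmul_mem {h : G}
    (hneg : ∀ g ∈ G0, -g ∈ AddSubmonoid.closure G0) {m : ℕ} (hm : 0 < m)
    (hmh : m • h ∈ AddSubmonoid.closure (G0 \ {h})) {x : G}
    (hx : x ∈ AddSubmonoid.closure (G0 \ {h})) : -x ∈ AddSubmonoid.closure (G0 \ {h}) := by
  induction hx using AddSubmonoid.closure_induction with
  | mem g hg =>
    obtain ⟨T, hT, hTsum⟩ := AddSubmonoid.exists_multiset_of_mem_closure (hneg g hg.1)
    have hsum := T.sum_filter_ne_add h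
    have hmem : m • (-g) ∈ AddSubmonoid.closure (G0 \ {h}) := by
      rw [← hTsum, ← hsum, nsmul_add, nsmul_left_comm]
      refine add_mem (nsmul_mem (AddSubmonoid.multiset_sum_mem _ _ fun x hx => ?_) _)
        (nsmul_mem hmh _)
      obtain ⟨hx1, hx2⟩ := Multiset.mem_filter.mp hx
      exact AddSubmonoid.subset_closure ⟨hT x hx1, hx2⟩
    have he : -g = m • (-g) + (m - 1) • g := by
      obtain ⟨k, rfl⟩ : ∃ k, m = k + 1 := ⟨m - 1, by omega⟩
      rw [Nat.add_sub_cancel, succ_nsmul, smul_neg]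
      abel
    rw [he]
    exact add_mem hmem (nsmul_mem (AddSubmonoid.subset_closure hg) _)
  | zero => simp
  | add y z _ _ hy hz => rw [neg_add]; exact add_mem hy hz

end Reduction

/-- If a zero-sum sequence over `G0` generates `G0` as a group, then the monoid of zero-sum
sequences over `G0` has a transfer homomorphism onto one whose inclusion is a divisor theory. -/
theorem exists_transferHom_isDivisorTheoryB.{u} (N : ℕ) :
    ∀ (G : Type u) [AddCommGroup G] (G0 : Set G) (S : Multiset G), IsFGAdd G → S ∈ ZeroSum G0 →
      G0 ⊆ AddSubgroup.closure {g | g ∈ S} → S.card ≤ N →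
      ∃ (Gs : Type u) (_ : AddCommGroup Gs) (G0s : Set Gs), IsFGAdd Gs ∧ IsDivisorTheoryB G0s ∧
        ∃ θ : ZeroSum G0 →+ ZeroSum G0s, IsTransferHomAdd θ := by
  induction N using Nat.strong_induction_on with
  | _ N ih =>
  intro G _ G0 S hG hS hgen hN
  by_cases hgood : ∀ g ∈ G0, ∀ k ∈ G0, -g ∈ AddSubmonoid.closure (G0 \ {k})
  · exact ⟨G, inferInstance, G0, hG, isDivisorTheoryB_of_neg_mem_closure hgood,
      AddMonoidHom.id _, Function.surjective_id, fun _ h => h, fun _ b c h => ⟨b, c, h, rfl, rfl⟩⟩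
  push Not at hgood
  obtain ⟨g, hg, h, hh, hbad⟩ := hgood
  suffices hstep : ∃ (G' : Type u) (_ : AddCommGroup G') (G0' : Set G') (S' : Multiset G'),
      IsFGAdd G' ∧ S' ∈ ZeroSum G0' ∧ G0' ⊆ AddSubgroup.closure {g | g ∈ S'} ∧ S'.card < S.card ∧
      ∃ θ : ZeroSum G0 →+ ZeroSum G0', IsTransferHomAdd θ by
    obtain ⟨G', _, G0', S', hG', hS', hgen', hcard, θ, hθ⟩ := hstep
    obtain ⟨Gs, inst, G0s, h1, h2, θ', hθ'⟩ :=
      ih S'.card (hcard.trans_le hN) G' G0' S' hG' hS' hgen' le_rfl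
    exact ⟨Gs, inst, G0s, h1, h2, θ'.comp θ, hθ'.comp hθ⟩
  have hSh : ∀ x ∈ S.filter (· ≠ h), x ∈ G0 \ {h} := fun x hx =>
    ⟨hS.1 x (Multiset.mem_of_mem_filter hx), (Multiset.mem_filter.mp hx).2⟩
  have hSmem : h ∉ AddSubmonoid.closure (G0 \ {h}) → h ∈ S := fun hcl => by
    by_contra hnot
    have hsub : {g | g ∈ S} ⊆ G0 \ {h} := fun x hx =>
      ⟨hS.1 x hx, fun hxh => hnot (Set.mem_singleton_iff.mp hxh ▸ hx)⟩
    exact hcl (AddSubmonoid.closure_mono hsub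
      (mem_addSubmonoid_closure_of_sum_eq_zero hS.2 (hgen hh)))
  have hcardS : (S.filter (· ≠ h)).card + S.count h = S.card := by
    conv_rhs => rw [← S.filter_ne_add_replicate h]
    simp
  by_cases hm : ∃ m : ℕ, 0 < m ∧ m • h ∈ AddSubmonoid.closure (G0 \ {h})
  · have hn := Nat.find_spec hm
    have hmin := fun k => Nat.find_min hm (m := k)
    generalize Nat.find hm = n at hn hmin
    have hneg0 : ∀ g ∈ G0, -g ∈ AddSubmonoid.closure G0 := fun g hg =>
      AddSubmonoid.closure_mono (fun x hx => hS.1 x hx)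
        (mem_addSubmonoid_closure_of_sum_eq_zero hS.2 (neg_mem (hgen hg)))
    have hnegK : ∀ x ∈ AddSubmonoid.closure (G0 \ {h}), -x ∈ AddSubmonoid.closure (G0 \ {h}) :=
      fun x hx => neg_mem_closure_of_nsmul_mem hneg0 hn.1 hn.2 hx
    have hhK : h ∉ AddSubmonoid.closure (G0 \ {h}) := fun hcl => by
      refine hbad (hnegK g ?_)
      by_cases hgh : g = h
      · rwa [hgh]
      · exact AddSubmonoid.subset_closure ⟨hg, hgh⟩
    have hdvd : ∀ j : ℕ, j • h ∈ AddSubmonoid.closure (G0 \ {h}) → n ∣ j := fun j hj => by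
      refine Nat.dvd_of_mod_eq_zero (Nat.eq_zero_of_not_pos fun hpos => ?_)
      refine hmin (j % n) (Nat.mod_lt _ hn.1) ⟨hpos, ?_⟩
      have he : (j % n) • h = j • h + -((j / n) • n • h) := by
        rw [← mul_nsmul', eq_add_neg_iff_add_eq, ← add_nsmul, Nat.mod_add_div']
      rw [he]
      exact add_mem hj (hnegK _ (nsmul_mem hn.2 _))
    have hdvdB : ∀ T ∈ ZeroSum G0, n ∣ T.count h := fun T hT => by
      refine hdvd _ ?_
      have hsum := T.sum_filter_ne_add h
      rw [hT.2] at hsum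
      rw [eq_neg_of_add_eq_zero_right hsum]
      refine hnegK _ (AddSubmonoid.multiset_sum_mem _ _ fun x hx => ?_)
      obtain ⟨hx1, hx2⟩ := Multiset.mem_filter.mp hx
      exact AddSubmonoid.subset_closure ⟨hT.1 x hx1, hx2⟩
    obtain ⟨θ, hθ, hθS⟩ := exists_transferHom_nsmul hh hn.1 hdvdB
    have hn2 : 2 ≤ n := by
      by_contra! hlt
      obtain rfl : n = 1 := by have := hn.1; omega
      exact hhK (by simpa using hn.2)
    have hcpos : 0 < S.count h := Multiset.count_pos.mpr (hSmem hhK)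
    have hcdiv : 0 < S.count h / n := Nat.div_pos (Nat.le_of_dvd hcpos (hdvdB S hS)) hn.1
    have hS' := hθS ⟨S, hS⟩
    have hnh : n • h ∈ (θ ⟨S, hS⟩ : Multiset G) := by
      rw [hS', Multiset.mem_add]
      exact .inr (Multiset.mem_replicate.mpr ⟨hcdiv.ne', rfl⟩)
    have hother : ∀ x ∈ S, x ≠ h → x ∈ (θ ⟨S, hS⟩ : Multiset G) := fun x hx hxh => by
      rw [hS', Multiset.mem_add]
      exact .inl (Multiset.mem_filter.mpr ⟨hx, hxh⟩)
    refine ⟨G, inferInstance, _, θ ⟨S, hS⟩, hG, (θ ⟨S, hS⟩).2, ?_, ?_, θ, hθ⟩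
    · rintro _ ⟨x, hx, rfl⟩
      by_cases hxh : x = h
      · simp only [hxh, if_true]
        exact AddSubgroup.subset_closure hnh
      · simp only [hxh, if_false]
        obtain ⟨T, hT, hTsum⟩ := AddSubmonoid.exists_multiset_of_mem_closure
          (mem_addSubmonoid_closure_of_sum_eq_zero hS.2 (hgen hx))
        have hsum := T.sum_filter_ne_add h
        rw [hTsum] at hsum
        have hd : n ∣ T.count h := by
          refine hdvd _ ?_
          rw [eq_sub_of_add_eq' hsum, sub_eq_add_neg]
          refine add_mem (AddSubmonoid.subset_closure ⟨hx, hxh⟩)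
            (hnegK _ (AddSubmonoid.multiset_sum_mem _ _ fun y hy => ?_))
          obtain ⟨hy1, hy2⟩ := Multiset.mem_filter.mp hy
          exact AddSubmonoid.subset_closure ⟨hS.1 y (hT y hy1), hy2⟩
        obtain ⟨k, hk⟩ := hd
        rw [← hsum, hk, mul_nsmul]
        refine add_mem (AddSubgroup.multiset_sum_mem _ _ fun y hy => ?_)
          (nsmul_mem (AddSubgroup.subset_closure (k := {g | g ∈ _}) hnh) _)
        obtain ⟨hy1, hy2⟩ := Multiset.mem_filter.mp hy
        exact AddSubgroup.subset_closure (hother y (hT y hy1) hy2)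
    · rw [hS', Multiset.card_add, Multiset.card_replicate, ← hcardS]
      exact Nat.add_lt_add_left (Nat.div_lt_self hcpos hn2) _
  · push Not at hm
    obtain ⟨θ, hθ, hθS⟩ := exists_transferHom_quotient hh hm
    have hcpos : 0 < S.count h :=
      Multiset.count_pos.mpr (hSmem (by simpa using hm 1 one_pos))
    have hS' := hθS ⟨S, hS⟩
    refine ⟨G ⧸ AddSubgroup.zmultiples h, inferInstance, _, θ ⟨S, hS⟩,
      hG.of_surjective _ (QuotientAddGroup.mk'_surjective _), (θ ⟨S, hS⟩).2, ?_, ?_, θ, hθ⟩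
    · rintro _ ⟨x, hx, rfl⟩
      have hle : AddSubgroup.closure {g | g ∈ S} ≤ (AddSubgroup.closure
          {g | g ∈ (θ ⟨S, hS⟩ : Multiset (G ⧸ AddSubgroup.zmultiples h))}).comap
            (QuotientAddGroup.mk' (AddSubgroup.zmultiples h)) := by
        refine (AddSubgroup.closure_le _).mpr fun y hy => ?_
        change QuotientAddGroup.mk' (AddSubgroup.zmultiples h) y ∈ AddSubgroup.closure _
        by_cases hyh : y = h
        · rw [hyh, QuotientAddGroup.mk'_apply,
            (QuotientAddGroup.eq_zero_iff h).mpr (AddSubgroup.mem_zmultiples h)]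
          exact zero_mem _
        · refine AddSubgroup.subset_closure ?_
          rw [Set.mem_ofPred_eq, hS']
          exact Multiset.mem_map_of_mem _ (Multiset.mem_filter.mpr ⟨hy, hyh⟩)
      exact hle (hgen hx.1)
    · rw [hS', Multiset.card_map]
      change (S.filter (· ≠ h)).card < _
      omega

section DivisorTheory

variable {P : Type*} {H : AddSubmonoid (P →₀ ℕ)}

theorem IsDivTheoryF.isCofinalF (hdt : IsDivTheoryF H) : IsCofinalF H := by
  intro x
  induction x using Finsupp.induction_linear with
  | zero => exact ⟨0, H.zero_mem, le_rfl⟩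
  | add x y hx hy =>
    obtain ⟨a, ha, hxa⟩ := hx
    obtain ⟨b, hb, hyb⟩ := hy
    exact ⟨a + b, H.add_mem ha hb, add_le_add hxa hyb⟩
  | single p n =>
    obtain ⟨X, hX, hXH, hinf⟩ := hdt.2 p
    obtain ⟨a, ha⟩ := hX
    have hle : 1 ≤ a p := by
      have h1 := hinf p
      rw [Finsupp.single_eq_same] at h1
      rw [← h1]
      exact Finset.inf'_le (fun h : P →₀ ℕ => h p) ha
    refine ⟨n • a, H.nsmul_mem (hXH ha) n, Finsupp.single_le_iff.mpr ?_⟩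
    simpa using Nat.mul_le_mul_left n hle

theorem IsDivHomF.mem_of_toIntF_mem (hdh : IsDivHomF H) {x : P →₀ ℕ}
    (hx : toIntF x ∈ qHsub H) : x ∈ H := by
  have key : ∀ y ∈ qHsub H, ∃ a ∈ H, ∃ b ∈ H, y = toIntF a - toIntF b := by
    intro y hy
    induction hy using AddSubgroup.closure_induction with
    | mem y hy =>
      obtain ⟨a, ha, rfl⟩ := hy
      exact ⟨a, ha, 0, H.zero_mem, by simp⟩
    | zero => exact ⟨0, H.zero_mem, 0, H.zero_mem, by simp⟩
    | add y z _ _ hy hz =>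
      obtain ⟨a, ha, b, hb, rfl⟩ := hy
      obtain ⟨c, hc, d, hd, rfl⟩ := hz
      exact ⟨a + c, H.add_mem ha hc, b + d, H.add_mem hb hd, by simp only [map_add]; abel⟩
    | neg y _ hy =>
      obtain ⟨a, ha, b, hb, rfl⟩ := hy
      exact ⟨b, hb, a, ha, by abel⟩
  obtain ⟨a, ha, b, hb, hab⟩ := key _ hx
  have hsum : a = b + x := by
    have hinj : Function.Injective (toIntF (P := P)) :=
      Finsupp.mapRange_injective _ rfl Nat.cast_injective
    apply hinj
    rw [map_add, hab]; abel
  have hle : b ≤ a := hsum ▸ le_self_add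
  have := hdh b hb a ha hle
  rwa [hsum, add_tsub_cancel_left] at this

theorem sum_map_clsOf (H : AddSubmonoid (P →₀ ℕ)) (x : P →₀ ℕ) :
    ((Finsupp.toMultiset x).map fun p => clsOf H (Finsupp.single p 1)).sum =
      clsOf H (toIntF x) := by
  induction x using Finsupp.induction_linear with
  | zero => simp
  | add x y hx hy => simp only [map_add, Multiset.map_add, Multiset.sum_add, hx, hy]
  | single p n =>
    have h : toIntF (Finsupp.single p n) = n • Finsupp.single p (1 : ℤ) := by
      simp [toIntF]
    rw [h, map_nsmul, Finsupp.toMultiset_single, Multiset.map_nsmul, Multiset.sum_nsmul,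
      Multiset.map_singleton, Multiset.sum_singleton]

theorem clsOf_toIntF_eq_zero_iff (hdh : IsDivHomF H) (x : P →₀ ℕ) :
    clsOf H (toIntF x) = 0 ↔ x ∈ H :=
  (QuotientAddGroup.eq_zero_iff _).trans
    ⟨hdh.mem_of_toIntF_mem, fun hx => AddSubgroup.subset_closure ⟨x, hx, rfl⟩⟩

theorem exists_transferHom_classGrp (hdh : IsDivHomF H) :
    ∃ θ : H →+ ZeroSum ((fun p => clsOf H (Finsupp.single p 1)) '' Set.univ),
      IsTransferHomAdd θ ∧ ∀ x : H, (θ x : Multiset (ClassGrp H)) =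
        (Finsupp.toMultiset (x : P →₀ ℕ)).map fun p => clsOf H (Finsupp.single p 1) := by
  refine exists_transferHom_zeroSum
    (Multiset.toFinsupp.symm.toAddMonoidHom.comp H.subtype)
    (Multiset.toFinsupp.symm.injective.comp Subtype.val_injective) Set.univ _ fun s => ?_
  obtain ⟨x, rfl⟩ := Multiset.toFinsupp.symm.surjective s
  change _ ↔ _ ∧ (Multiset.map _ (Finsupp.toMultiset x)).sum = 0
  rw [sum_map_clsOf, clsOf_toIntF_eq_zero_iff hdh]
  refine ⟨?_, fun hx => ⟨⟨x, hx.2⟩, rfl⟩⟩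
  rintro ⟨m, hm⟩
  exact ⟨fun _ _ => Set.mem_univ _, Multiset.toFinsupp.symm.injective hm ▸ m.2⟩

theorem exists_mem_closure_eq_top (hcof : IsCofinalF H) (hfg : IsFGAdd (ClassGrp H)) :
    ∃ x ∈ H, AddSubgroup.closure {g | g ∈ (Finsupp.toMultiset x).map
      fun p => clsOf H (Finsupp.single p 1)} = ⊤ := by
  obtain ⟨A, hA⟩ := hfg
  have hlift : ∀ a : ClassGrp H, ∃ z, clsOf H z = a := QuotientAddGroup.mk'_surjective _
  choose z hz using hlift
  obtain ⟨x, hx, hle⟩ := hcof (∑ a ∈ A, (z a).mapRange Int.natAbs rfl)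
  refine ⟨x, hx, top_unique (hA ▸ (AddSubgroup.closure_le _).mpr fun a ha => ?_)⟩
  rw [← hz a, ← (z a).sum_single, Finsupp.sum, map_sum]
  refine sum_mem fun p hp => ?_
  have hs : Finsupp.single p (z a p) = z a p • Finsupp.single p (1 : ℤ) := by simp
  rw [hs, map_zsmul]
  refine zsmul_mem (AddSubgroup.subset_closure ?_) _
  refine Multiset.mem_map_of_mem (fun p => clsOf H (Finsupp.single p 1)) ?_
  rw [Finsupp.mem_toMultiset, Finsupp.mem_support_iff]
  have h1 : (z a).mapRange Int.natAbs rfl ≤ ∑ a ∈ A, (z a).mapRange Int.natAbs rfl :=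
    Finset.single_le_sum (f := fun a => (z a).mapRange Int.natAbs rfl) (fun _ _ => zero_le) ha
  have h2 : (z a p).natAbs ≤ x p := (h1.trans hle) p
  have h3 := Finsupp.mem_support_iff.mp hp
  omega

end DivisorTheory

/-- Let `H ⊆ F(P)` be a submonoid such that `H ↪ F(P)` is a divisor
theory with finitely generated class group `G = q(F)/q(H)`. Then there exist a finitely
generated abelian group `G*`, a subset `G₀* ⊆ G*` such that `B(G₀*) ↪ F(G₀*)` is a
divisor theory, and a transfer homomorphism `θ* : H → B(G₀*)`; moreover
`L(H) = L(B(G₀*))`. -/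
theorem transfer_of_krull_fg_class_group.{u} {P : Type u} (H : AddSubmonoid (P →₀ ℕ))
    (hdt : IsDivTheoryF H) (hfg : IsFGAdd (ClassGrp H)) :
    ∃ (Gs : Type u) (instG : AddCommGroup Gs) (G0s : Set Gs),
      (@IsFGAdd Gs instG) ∧
      (@IsDivisorTheoryB Gs instG G0s) ∧
      ∃ θ : ↥H →+ ↥(@ZeroSum Gs instG G0s),
        IsTransferHomAdd θ ∧
        addSystemOfLengths ↥H = addSystemOfLengths ↥(@ZeroSum Gs instG G0s) := by
  obtain ⟨θ₁, hθ₁, hval⟩ := exists_transferHom_classGrp hdt.1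
  obtain ⟨x, hx, hgen⟩ := exists_mem_closure_eq_top hdt.isCofinalF hfg
  rw [← hval ⟨x, hx⟩] at hgen
  obtain ⟨Gs, inst, G0s, h1, h2, θ₂, hθ₂⟩ := exists_transferHom_isDivisorTheoryB _ _ _
    (θ₁ ⟨x, hx⟩ : Multiset (ClassGrp H)) hfg (θ₁ ⟨x, hx⟩).2
    (fun g _ => by rw [hgen]; exact AddSubgroup.mem_top g) le_rfl
  exact ⟨Gs, inst, G0s, h1, h2, θ₂.comp θ₁, hθ₂.comp hθ₁,
    (hθ₂.comp hθ₁).addSystemOfLengths_eq H.eq_zero_of_isAddUnit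
      (ZeroSum G0s).eq_zero_of_isAddUnit⟩
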